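/- The map Sp(V,Ω) → GL(V,j) × 𝔹(V,Ω,j), g ↦ (C_g, Z_g), is injective, and its image is exactly the set of pairs (C,Z) with Id − Z² = (C*∘C)⁻¹. In particular, for any j-linear invertible C and any Z ∈ 𝔹(V,Ω,j) satisfying Id − Z² = (C*∘C)⁻¹, the endomorphism g := C∘(Id + Z) is symplectic, and C_g = C, Z_g = Z. -/

import Mathlib

/-- The Hermitean inner product `⟨v,w⟩_j := Ω(v,jw) − i·Ω(v,w)`. -/
noncomputable def herm {V : Type*} [AddCommGroup V] [Module ℝ V]
    (Ω : V →ₗ[ℝ] V →ₗ[ℝ] ℝ) (j : Module.End ℝ V) (v w : V) : ℂ :=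
  (Ω v (j w) : ℂ) - Complex.I * (Ω v w : ℂ)

/-- Membership in the Siegel domain `𝔹(V,Ω,j)`. -/
def InSiegel {V : Type*} [AddCommGroup V] [Module ℝ V]
    (Ω : V →ₗ[ℝ] V →ₗ[ℝ] ℝ) (j : Module.End ℝ V) (Z : Module.End ℝ V) : Prop :=
  Z * j = -(j * Z) ∧ (∀ v w, herm Ω j v (Z w) = herm Ω j w (Z v)) ∧
    (∀ v, v ≠ 0 → 0 < Ω ((1 - Z * Z) v) (j v))

/-- `C_g := ½(g − j∘g∘j)`. -/
noncomputable def Cmap {V : Type*} [AddCommGroup V] [Module ℝ V]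
    (j g : Module.End ℝ V) : Module.End ℝ V := (1/2 : ℝ) • (g - j * g * j)

/-- `D_g := ½(g + j∘g∘j)`. -/
noncomputable def Dmap {V : Type*} [AddCommGroup V] [Module ℝ V]
    (j g : Module.End ℝ V) : Module.End ℝ V := (1/2 : ℝ) • (g + j * g * j)

/-- `Z_g := C_g⁻¹ ∘ D_g`. -/
noncomputable def Zmap {V : Type*} [AddCommGroup V] [Module ℝ V]
    (j g : Module.End ℝ V) : Module.End ℝ V := Ring.inverse (Cmap j g) * Dmap j g

section SymplecticLinear

variable {V : Type*} [AddCommGroup V] [Module ℝ V]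
  {Ω : V →ₗ[ℝ] V →ₗ[ℝ] ℝ} {j : Module.End ℝ V}

theorem herm_eq_herm_iff (a b c d : V) :
    herm Ω j a b = herm Ω j c d ↔ Ω a (j b) = Ω c (j d) ∧ Ω a b = Ω c d := by
  simp [herm, Complex.ext_iff]

theorem apply_apply_of_mul_self_eq_neg_one (hj2 : j * j = -1) (v : V) : j (j v) = -v := by
  simpa using LinearMap.congr_fun hj2 v

theorem symplectic_swap (hΩalt : ∀ v, Ω v v = 0) (v w : V) : Ω v w = -Ω w v := by
  have h := hΩalt (v + w)
  simp only [map_add, LinearMap.add_apply, hΩalt] at h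
  linarith

theorem symplectic_left_complex (hj2 : j * j = -1) (hjsymp : ∀ v w, Ω (j v) (j w) = Ω v w)
    (v w : V) : Ω (j v) w = -Ω v (j w) := by
  rw [← hjsymp (j v) w, apply_apply_of_mul_self_eq_neg_one hj2]
  simp

theorem endomorphism_ext_of_nondegenerate (hΩalt : ∀ v, Ω v v = 0)
    (hΩnondeg : ∀ v, (∀ w, Ω v w = 0) → v = 0) {A B : Module.End ℝ V}
    (h : ∀ v w, Ω v (A w) = Ω v (B w)) : A = B := by
  ext w
  refine sub_eq_zero.mp (hΩnondeg _ fun v => ?_)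
  rw [symplectic_swap hΩalt, map_sub, h, sub_self, neg_zero]

theorem exists_symplectic_adjoint [FiniteDimensional ℝ V]
    (hΩalt : ∀ v, Ω v v = 0) (hΩnondeg : ∀ v, (∀ w, Ω v w = 0) → v = 0)
    (A : Module.End ℝ V) : ∃ B : Module.End ℝ V, ∀ v w, Ω (A v) w = Ω v (B w) := by
  have hinj : Function.Injective Ω := by
    refine (injective_iff_map_eq_zero Ω).mpr fun v hv => hΩnondeg v fun w => ?_
    rw [hv, LinearMap.zero_apply]
  let e : V ≃ₗ[ℝ] (V →ₗ[ℝ] ℝ) :=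
    LinearMap.linearEquivOfInjective Ω hinj (Subspace.dual_finrank_eq (K := ℝ) (V := V)).symm
  have he (f : V →ₗ[ℝ] ℝ) : Ω (e.symm f) = f := e.apply_symm_apply f
  refine ⟨e.symm.toLinearMap ∘ₗ (LinearMap.lcomp ℝ ℝ A) ∘ₗ Ω, fun v w => ?_⟩
  rw [symplectic_swap hΩalt v]
  simp only [LinearMap.comp_apply, LinearEquiv.coe_coe, he, LinearMap.lcomp_apply]
  exact symplectic_swap hΩalt _ _

theorem Cmap_add_Dmap (g : Module.End ℝ V) : Cmap j g + Dmap j g = g := by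
  simp only [Cmap, Dmap]
  module

theorem Cmap_mul_complex (hj2 : j * j = -1) (g : Module.End ℝ V) :
    Cmap j g * j = j * Cmap j g := by
  have h₁ : j * g * j * j = -(j * g) := by rw [mul_assoc, hj2, mul_neg_one]
  have h₂ : j * (j * g * j) = -(g * j) := by
    rw [mul_assoc, ← mul_assoc, hj2, neg_one_mul]
  simp only [Cmap, smul_mul_assoc, mul_smul_comm, sub_mul, mul_sub, h₁, h₂]
  module

theorem Dmap_mul_complex (hj2 : j * j = -1) (g : Module.End ℝ V) :
    Dmap j g * j = -(j * Dmap j g) := by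
  have h₁ : j * g * j * j = -(j * g) := by rw [mul_assoc, hj2, mul_neg_one]
  have h₂ : j * (j * g * j) = -(g * j) := by
    rw [mul_assoc, ← mul_assoc, hj2, neg_one_mul]
  simp only [Dmap, smul_mul_assoc, mul_smul_comm, add_mul, mul_add, h₁, h₂]
  module

theorem symplectic_Cmap_add_Dmap (hjsymp : ∀ v w, Ω (j v) (j w) = Ω v w)
    {g : Module.End ℝ V} (hg : ∀ v w, Ω (g v) (g w) = Ω v w) (v w : V) :
    Ω (Cmap j g v) (Cmap j g w) + Ω (Dmap j g v) (Dmap j g w) = Ω v w := by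
  simp only [Cmap, Dmap, LinearMap.smul_apply, LinearMap.sub_apply, LinearMap.add_apply,
    Module.End.mul_apply, map_smul, map_add, map_sub, smul_eq_mul, hjsymp, hg]
  ring

theorem symplectic_Cmap_Dmap_cross (hjsymp : ∀ v w, Ω (j v) (j w) = Ω v w)
    {g : Module.End ℝ V} (hg : ∀ v w, Ω (g v) (g w) = Ω v w) (v w : V) :
    Ω (Cmap j g v) (Dmap j g w) + Ω (Dmap j g v) (Cmap j g w) = 0 := by
  simp only [Cmap, Dmap, LinearMap.smul_apply, LinearMap.sub_apply, LinearMap.add_apply,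
    Module.End.mul_apply, map_smul, map_add, map_sub, smul_eq_mul, hjsymp, hg]
  ring

theorem isUnit_Cmap [FiniteDimensional ℝ V] (hj2 : j * j = -1)
    (hjsymp : ∀ v w, Ω (j v) (j w) = Ω v w) (hjpos : ∀ v, v ≠ 0 → 0 < Ω v (j v))
    {g : Module.End ℝ V} (hg : ∀ v w, Ω (g v) (g w) = Ω v w) : IsUnit (Cmap j g) := by
  refine (LinearMap.isUnit_iff_ker_eq_bot _).mpr (LinearMap.ker_eq_bot'.mpr fun v hv => ?_)
  by_contra hne
  have h := symplectic_Cmap_add_Dmap hjsymp hg v (j v)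
  have hD : Dmap j g (j v) = -j (Dmap j g v) := LinearMap.congr_fun (Dmap_mul_complex hj2 g) v
  rw [hv, hD, map_zero, LinearMap.zero_apply, zero_add, map_neg] at h
  have hv' := hjpos v hne
  by_cases h0 : Dmap j g v = 0
  · rw [h0] at h
    simp at h
    linarith
  · linarith [hjpos _ h0]

theorem Cmap_mul_Zmap {g : Module.End ℝ V} (hC : IsUnit (Cmap j g)) :
    Cmap j g * Zmap j g = Dmap j g := by
  rw [Zmap, ← mul_assoc, Ring.mul_inverse_cancel _ hC, one_mul]

theorem Zmap_mul_complex (hj2 : j * j = -1) {g : Module.End ℝ V} (hC : IsUnit (Cmap j g)) :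
    Zmap j g * j = -(j * Zmap j g) := by
  apply hC.mul_left_cancel
  rw [← mul_assoc, Cmap_mul_Zmap hC, Dmap_mul_complex hj2, mul_neg, ← mul_assoc,
    Cmap_mul_complex hj2, mul_assoc, Cmap_mul_Zmap hC]

theorem Cmap_mul_one_add {C Z : Module.End ℝ V} (hj2 : j * j = -1) (hC : C * j = j * C)
    (hZ : Z * j = -(j * Z)) : Cmap j (C * (1 + Z)) = C := by
  have h : j * (C * (1 + Z)) * j = -(C * (1 - Z)) := by
    calc j * (C * (1 + Z)) * j = j * C * (j + Z * j) := by noncomm_ring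
      _ = C * (j * j) * (1 - Z) := by rw [hZ, ← hC]; noncomm_ring
      _ = -(C * (1 - Z)) := by rw [hj2]; noncomm_ring
  rw [Cmap, h, mul_add, mul_sub, mul_one]
  module

theorem Zmap_mul_one_add {C Z : Module.End ℝ V} (hj2 : j * j = -1) (hC : C * j = j * C)
    (hu : IsUnit C) (hZ : Z * j = -(j * Z)) : Zmap j (C * (1 + Z)) = Z := by
  have hc := Cmap_mul_one_add hj2 hC hZ
  apply hu.mul_left_cancel
  have h := Cmap_add_Dmap (j := j) (C * (1 + Z))
  rw [← Cmap_mul_Zmap (hc.symm ▸ hu), hc] at h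
  exact add_left_cancel (h.trans (by rw [mul_add, mul_one]))

section Zmap

variable {g : Module.End ℝ V} (hC : IsUnit (Cmap j g))
  (hjsymp : ∀ v w, Ω (j v) (j w) = Ω v w) (hg : ∀ v w, Ω (g v) (g w) = Ω v w)
include hC hjsymp hg

theorem symplectic_Cmap_one_sub_Zmap_sq (v w : V) :
    Ω (Cmap j g v) (Cmap j g ((1 - Zmap j g * Zmap j g) w)) = Ω v w := by
  have hD (x : V) : Dmap j g x = Cmap j g (Zmap j g x) :=
    (LinearMap.congr_fun (Cmap_mul_Zmap hC) x).symm
  have h₁ := symplectic_Cmap_add_Dmap hjsymp hg v w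
  have h₂ := symplectic_Cmap_Dmap_cross hjsymp hg v (Zmap j g w)
  simp only [hD] at h₁ h₂
  simp only [LinearMap.sub_apply, Module.End.mul_apply, Module.End.one_apply, map_sub]
  linarith

theorem symplectic_Zmap_swap (hΩalt : ∀ v, Ω v v = 0) (v w : V) :
    Ω v (Zmap j g w) = Ω w (Zmap j g v) := by
  have hD (x : V) : Dmap j g x = Cmap j g (Zmap j g x) :=
    (LinearMap.congr_fun (Cmap_mul_Zmap hC) x).symm
  have h₁ := symplectic_Cmap_add_Dmap hjsymp hg v (Zmap j g w)
  have h₂ := symplectic_Cmap_add_Dmap hjsymp hg (Zmap j g v) w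
  have h₃ := symplectic_Cmap_Dmap_cross hjsymp hg v w
  have h₄ := symplectic_Cmap_Dmap_cross hjsymp hg (Zmap j g v) (Zmap j g w)
  simp only [hD] at h₁ h₂ h₃ h₄
  rw [symplectic_swap hΩalt w]
  linarith

theorem inSiegel_Zmap (hΩalt : ∀ v, Ω v v = 0) (hΩnondeg : ∀ v, (∀ w, Ω v w = 0) → v = 0)
    (hj2 : j * j = -1) (hjpos : ∀ v, v ≠ 0 → 0 < Ω v (j v)) : InSiegel Ω j (Zmap j g) := by
  have hZj := Zmap_mul_complex hj2 hC
  have hZ (x : V) : Zmap j g (j x) = -j (Zmap j g x) := LinearMap.congr_fun hZj x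
  have hCj (x : V) : Cmap j g (j x) = j (Cmap j g x) :=
    LinearMap.congr_fun (Cmap_mul_complex hj2 g) x
  refine ⟨hZj, fun v w => (herm_eq_herm_iff _ _ _ _).mpr ⟨?_, ?_⟩, fun v hv => ?_⟩
  · have h := symplectic_Zmap_swap hC hjsymp hg hΩalt v (j w)
    rw [hZ, map_neg, symplectic_left_complex hj2 hjsymp] at h
    linarith
  · exact symplectic_Zmap_swap hC hjsymp hg hΩalt v w
  · have hQ := symplectic_Cmap_one_sub_Zmap_sq hC hjsymp hg
    have hcomm : (1 - Zmap j g * Zmap j g) (j v) = j ((1 - Zmap j g * Zmap j g) v) := by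
      simp [hZ]
    rw [← hQ, hcomm, hCj]
    refine hjpos _ fun h0 => hv (hΩnondeg v fun w => ?_)
    rw [symplectic_swap hΩalt, ← hQ, h0, map_zero, neg_zero]

end Zmap

theorem symplectic_mul_one_add {C Z Cs : Module.End ℝ V}
    (hΩalt : ∀ v, Ω v v = 0) (hCs : ∀ v w, Ω (C v) w = Ω v (Cs w))
    (hZ : ∀ v w, Ω v (Z w) = Ω w (Z v))
    (h₁ : (1 - Z * Z) * (Cs * C) = 1) (h₂ : (Cs * C) * (1 - Z * Z) = 1) (v w : V) :
    Ω ((C * (1 + Z)) v) ((C * (1 + Z)) w) = Ω v w := by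
  have hcomm : Commute (Cs * C) Z := by
    let u : (Module.End ℝ V)ˣ := ⟨Cs * C, 1 - Z * Z, h₂, h₁⟩
    have hu : Commute (↑u⁻¹ : Module.End ℝ V) Z :=
      show Commute (1 - Z * Z) Z from
        (Commute.one_left Z).sub_left ((Commute.refl Z).mul_left (Commute.refl Z))
    exact Commute.units_inv_left_iff.mp hu
  have hP : (1 - Z) * (Cs * C * (1 + Z)) = 1 := by
    rw [((Commute.one_right _).add_right hcomm).eq, ← mul_assoc]
    refine Eq.trans (congrArg (· * (Cs * C)) ?_) h₁
    noncomm_ring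
  have hadj (x y : V) : Ω ((1 + Z) x) y = Ω x ((1 - Z) y) := by
    simp only [LinearMap.add_apply, LinearMap.sub_apply, Module.End.one_apply, map_add, map_sub]
    rw [symplectic_swap hΩalt (Z x), hZ]
    ring
  calc Ω ((C * (1 + Z)) v) ((C * (1 + Z)) w)
      = Ω v (((1 - Z) * (Cs * C * (1 + Z))) w) := by
        simp only [Module.End.mul_apply, hCs, hadj]
    _ = Ω v w := by rw [hP, Module.End.one_apply]

end SymplecticLinear

/-- the map `Sp(V,Ω) → GL(V,j) × 𝔹(V,Ω,j), g ↦ (C_g,Z_g)` is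
injective and its image is exactly the set of pairs `(C,Z)` with
`Id − Z² = (C*∘C)⁻¹`; in particular `g := C∘(Id+Z)` is symplectic with
`C_g = C` and `Z_g = Z` for every such pair. -/
theorem stmt3 {V : Type*} [AddCommGroup V] [Module ℝ V] [FiniteDimensional ℝ V]
    (Ω : V →ₗ[ℝ] V →ₗ[ℝ] ℝ)
    (hΩalt : ∀ v, Ω v v = 0)
    (hΩnondeg : ∀ v, (∀ w, Ω v w = 0) → v = 0)
    (j : Module.End ℝ V)
    (hj2 : j * j = -1)
    (hjsymp : ∀ v w, Ω (j v) (j w) = Ω v w)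
    (hjpos : ∀ v, v ≠ 0 → 0 < Ω v (j v)) :
    -- injectivity
    (∀ g₁ g₂ : Module.End ℝ V,
      Function.Bijective g₁ → (∀ v w, Ω (g₁ v) (g₁ w) = Ω v w) →
      Function.Bijective g₂ → (∀ v w, Ω (g₂ v) (g₂ w) = Ω v w) →
      Cmap j g₁ = Cmap j g₂ → Zmap j g₁ = Zmap j g₂ → g₁ = g₂)
    -- the image is contained in the indicated set
    ∧ (∀ g : Module.End ℝ V,
        Function.Bijective g → (∀ v w, Ω (g v) (g w) = Ω v w) →
        (Cmap j g * j = j * Cmap j g ∧ IsUnit (Cmap j g))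
        ∧ InSiegel Ω j (Zmap j g)
        ∧ (∀ Cs : Module.End ℝ V,
            (∀ v w, herm Ω j (Cmap j g v) w = herm Ω j v (Cs w)) →
            (1 - Zmap j g * Zmap j g) * (Cs * Cmap j g) = 1
            ∧ (Cs * Cmap j g) * (1 - Zmap j g * Zmap j g) = 1))
    -- every pair in the indicated set is attained
    ∧ (∀ C Z : Module.End ℝ V,
        C * j = j * C → IsUnit C → InSiegel Ω j Z →
        (∀ Cs : Module.End ℝ V,
          (∀ v w, herm Ω j (C v) w = herm Ω j v (Cs w)) →
          (1 - Z * Z) * (Cs * C) = 1 ∧ (Cs * C) * (1 - Z * Z) = 1) →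
        (∀ v w, Ω ((C * (1 + Z) : Module.End ℝ V) v) ((C * (1 + Z) : Module.End ℝ V) w) = Ω v w)
        ∧ Function.Bijective (C * (1 + Z) : Module.End ℝ V)
        ∧ Cmap j (C * (1 + Z)) = C ∧ Zmap j (C * (1 + Z)) = Z) := by
  refine ⟨fun g₁ g₂ _ h₁ _ h₂ hCeq hZeq => ?_, fun g _ hg => ?_, fun C Z hCj hC hZ h => ?_⟩
  · rw [← Cmap_add_Dmap (j := j) g₁, ← Cmap_add_Dmap (j := j) g₂,
      ← Cmap_mul_Zmap (isUnit_Cmap hj2 hjsymp hjpos h₁),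
      ← Cmap_mul_Zmap (isUnit_Cmap hj2 hjsymp hjpos h₂), hCeq, hZeq]
  · have hC := isUnit_Cmap hj2 hjsymp hjpos hg
    refine ⟨⟨Cmap_mul_complex hj2 g, hC⟩,
      inSiegel_Zmap hC hjsymp hg hΩalt hΩnondeg hj2 hjpos, fun Cs hCs => ?_⟩
    have hinv : (Cs * Cmap j g) * (1 - Zmap j g * Zmap j g) = 1 := by
      refine endomorphism_ext_of_nondegenerate hΩalt hΩnondeg fun v w => ?_
      rw [Module.End.one_apply, ← symplectic_Cmap_one_sub_Zmap_sq hC hjsymp hg v w,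
        ((herm_eq_herm_iff _ _ _ _).mp (hCs v _)).2]
      rfl
    exact ⟨mul_eq_one_comm.mp hinv, hinv⟩
  · obtain ⟨Cs, hCs⟩ := exists_symplectic_adjoint hΩalt hΩnondeg C
    have hCsj : Cs * j = j * Cs := by
      refine endomorphism_ext_of_nondegenerate hΩalt hΩnondeg fun v w => ?_
      have hv : C (j v) = j (C v) := LinearMap.congr_fun hCj v
      have hjv := symplectic_left_complex hj2 hjsymp v (Cs w)
      rw [← hCs, hv, symplectic_left_complex hj2 hjsymp, hCs] at hjv
      exact neg_injective hjv
    obtain ⟨hinv₁, hinv₂⟩ := h Cs fun v w => (herm_eq_herm_iff _ _ _ _).mpr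
      ⟨(hCs v (j w)).trans (congrArg (Ω v) (LinearMap.congr_fun hCsj w)), hCs v w⟩
    have hsymp := symplectic_mul_one_add hΩalt hCs
      (fun v w => ((herm_eq_herm_iff _ _ _ _).mp (hZ.2.1 v w)).2) hinv₁ hinv₂
    have hinj : Function.Injective (C * (1 + Z) : Module.End ℝ V) := by
      refine (injective_iff_map_eq_zero _).mpr fun v hv => hΩnondeg v fun w => ?_
      rw [← hsymp, hv, map_zero, LinearMap.zero_apply]
    exact ⟨hsymp, ⟨hinj, LinearMap.injective_iff_surjective.mp hinj⟩,
      Cmap_mul_one_add hj2 hCj hZ.1, Zmap_mul_one_add hj2 hCj hC hZ.1⟩
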